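/- arXiv:math/0410530 — 7 statements merged into one kernel-verified Lean document; each statement's English description precedes it below -/
import Mathlib

section
/- The Fock operator T on ℓ²(ℕ, ℂ) satisfies the q-deformed canonical commutation relation T* T = q² T T* + (1 - q²)·1, where T* is the adjoint of T and 1 is the identity operator. (Hence T ↦ T_F(z) defines a *-representation of the algebra Pol(ℂ)_q with defining relation z*z = q²zz* + 1 - q².) -/
noncomputable section

/-- ℓ²(ℕ, ℂ), the Hilbert space of square-summable complex sequences. -/
abbrev ellTwo : Type := lp (fun _ : ℕ => ℂ) 2

/-- The standard orthonormal basis vectors of ℓ²(ℕ, ℂ). -/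
def e (n : ℕ) : ellTwo := lp.single 2 n 1

open scoped InnerProductSpace

theorem inner_e_left (n : ℕ) (f : ellTwo) : ⟪e n, f⟫_ℂ = f n := by
  simp [e, lp.inner_single_left]

/-- The adjoint of a weighted shift with real weights is the weighted backward shift. -/
theorem adjoint_weightedShift_apply {w : ℕ → ℝ} {T : ellTwo →L[ℂ] ellTwo}
    (hT : ∀ n, T (e n) = (w n : ℂ) • e (n + 1)) (f : ellTwo) (n : ℕ) :
    T.adjoint f n = w n * f (n + 1) := by
  rw [← inner_e_left, ContinuousLinearMap.adjoint_inner_right, hT, inner_smul_left, inner_e_left,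
    Complex.conj_ofReal]

theorem weightedShift_apply_zero {w : ℕ → ℝ} {T : ellTwo →L[ℂ] ellTwo}
    (hT : ∀ n, T (e n) = (w n : ℂ) • e (n + 1)) (f : ellTwo) : T f 0 = 0 := by
  have h : T.adjoint (e 0) = 0 := by
    ext m
    simp [adjoint_weightedShift_apply hT, e, lp.single_apply]
  rw [← inner_e_left, ← ContinuousLinearMap.adjoint_inner_left, h, inner_zero_left]

theorem weightedShift_apply_succ {w : ℕ → ℝ} {T : ellTwo →L[ℂ] ellTwo}
    (hT : ∀ n, T (e n) = (w n : ℂ) • e (n + 1)) (f : ellTwo) (n : ℕ) :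
    T f (n + 1) = w n * f n := by
  have h : T.adjoint (e (n + 1)) = (w n : ℂ) • e n := by
    ext m
    rw [adjoint_weightedShift_apply hT, lp.coeFn_smul, Pi.smul_apply]
    by_cases hm : m = n
    · subst hm; simp [e]
    · simp [e, lp.single_apply, hm]
  rw [← inner_e_left, ← ContinuousLinearMap.adjoint_inner_left, h, inner_smul_left, inner_e_left,
    Complex.conj_ofReal]

/-- The Fock operator `T` satisfies the q-deformed canonical commutation relation
`T* T = q² T T* + (1 - q²)·1`. -/
theorem stmt_1 (q : ℝ) (hq0 : 0 < q) (hq1 : q < 1)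
    (T : ellTwo →L[ℂ] ellTwo)
    (hT : ∀ n : ℕ, T (e n) = (Real.sqrt (1 - q ^ (2 * (n + 1))) : ℂ) • e (n + 1)) :
    ContinuousLinearMap.adjoint T * T =
      ((q : ℂ) ^ 2) • (T * ContinuousLinearMap.adjoint T) + (1 - (q : ℂ) ^ 2) • 1 := by
  have hw (n : ℕ) : (Real.sqrt (1 - q ^ (2 * (n + 1))) : ℂ) * Real.sqrt (1 - q ^ (2 * (n + 1))) =
      1 - (q : ℂ) ^ (2 * (n + 1)) := by
    rw [← Complex.ofReal_mul,
      Real.mul_self_sqrt (sub_nonneg.2 (pow_le_one₀ hq0.le hq1.le))]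
    push_cast
    rfl
  have hadj := adjoint_weightedShift_apply (w := fun n => Real.sqrt (1 - q ^ (2 * (n + 1)))) hT
  have hzero := weightedShift_apply_zero (w := fun n => Real.sqrt (1 - q ^ (2 * (n + 1)))) hT
  have hsucc := weightedShift_apply_succ (w := fun n => Real.sqrt (1 - q ^ (2 * (n + 1)))) hT
  ext f n
  change T.adjoint (T f) n = (q : ℂ) ^ 2 * T (T.adjoint f) n + (1 - (q : ℂ) ^ 2) * f n
  rw [hadj, hsucc, ← mul_assoc, hw]
  cases n with
  | zero => simp [hzero]
  | succ n =>
    rw [hsucc, hadj, ← mul_assoc (Complex.ofReal _), hw]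
    ring
end
end

section
/- The family of bounded operators { T^i (T*)^j : (i, j) ∈ ℕ × ℕ } is linearly independent over ℂ in the space of bounded linear operators on ℓ²(ℕ, ℂ), where T is the Fock operator and T* its adjoint. (This expresses faithfulness of the Fock representation of Pol(ℂ)_q, since the monomials z^i (z*)^j span Pol(ℂ)_q.) -/
noncomputable section

theorem e_apply (n m : ℕ) : (e n : ℕ → ℂ) m = if m = n then 1 else 0 := by
  by_cases h : m = n
  · subst h; simp [e]
  · simp [e, h]

theorem inner_e_left_s5 (m : ℕ) (x : ellTwo) : inner ℂ (e m) x = (x : ℕ → ℂ) m := by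
  rw [e, lp.inner_single_left]
  simp

section WeightedShift

variable {T : ellTwo →L[ℂ] ellTwo} {w : ℕ → ℂ}

theorem adjoint_e_apply (hT : ∀ n, T (e n) = w n • e (n + 1)) (n m : ℕ) :
    (ContinuousLinearMap.adjoint T (e n) : ℕ → ℂ) m =
      if m + 1 = n then starRingEnd ℂ (w m) else 0 := by
  rw [← inner_e_left_s5, ContinuousLinearMap.adjoint_inner_right, hT, inner_smul_left,
    inner_e_left_s5, e_apply]
  simp

theorem adjoint_e_zero (hT : ∀ n, T (e n) = w n • e (n + 1)) :
    ContinuousLinearMap.adjoint T (e 0) = 0 := by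
  ext m
  simp [adjoint_e_apply hT]

theorem adjoint_e_succ (hT : ∀ n, T (e n) = w n • e (n + 1)) (n : ℕ) :
    ContinuousLinearMap.adjoint T (e (n + 1)) = starRingEnd ℂ (w n) • e n := by
  ext m
  rw [adjoint_e_apply hT, lp.coeFn_smul, Pi.smul_apply, e_apply]
  by_cases h : m = n
  · simp [h]
  · simp [h]

theorem exists_pow_e_zero (hT : ∀ n, T (e n) = w n • e (n + 1)) (hw : ∀ n, w n ≠ 0) (i : ℕ) :
    ∃ c : ℂ, c ≠ 0 ∧ (T ^ i) (e 0) = c • e i := by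
  induction i with
  | zero => exact ⟨1, one_ne_zero, by simp⟩
  | succ i ih =>
    obtain ⟨c, hc, h⟩ := ih
    refine ⟨c * w i, mul_ne_zero hc (hw i), ?_⟩
    rw [pow_succ', mul_apply_eq_comp, h, map_smul, hT, smul_smul]

theorem exists_adjoint_pow_e_self (hT : ∀ n, T (e n) = w n • e (n + 1)) (hw : ∀ n, w n ≠ 0)
    (n : ℕ) : ∃ c : ℂ, c ≠ 0 ∧ (ContinuousLinearMap.adjoint T ^ n) (e n) = c • e 0 := by
  induction n with
  | zero => exact ⟨1, one_ne_zero, by simp⟩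
  | succ n ih =>
    obtain ⟨c, hc, h⟩ := ih
    refine ⟨starRingEnd ℂ (w n) * c, mul_ne_zero (by simpa using hw n) hc, ?_⟩
    rw [pow_succ, mul_apply_eq_comp, adjoint_e_succ hT, map_smul, h, smul_smul]

theorem adjoint_pow_e_of_lt (hT : ∀ n, T (e n) = w n • e (n + 1)) {n j : ℕ} (hnj : n < j) :
    (ContinuousLinearMap.adjoint T ^ j) (e n) = 0 := by
  induction j generalizing n with
  | zero => omega
  | succ j ih =>
    rw [pow_succ, mul_apply_eq_comp]
    cases n with
    | zero => rw [adjoint_e_zero hT, map_zero]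
    | succ n => rw [adjoint_e_succ hT, map_smul, ih (by omega), smul_zero]

/-- For a weighted shift `T` with nonzero weights, the normally ordered monomials in `T` and its
adjoint are linearly independent. -/
theorem linearIndependent_pow_mul_adjoint_pow (hT : ∀ n, T (e n) = w n • e (n + 1))
    (hw : ∀ n, w n ≠ 0) :
    LinearIndependent ℂ
      (fun p : ℕ × ℕ => T ^ p.1 * (ContinuousLinearMap.adjoint T) ^ p.2) := by
  rw [linearIndependent_iff']
  intro s g hg
  suffices H : ∀ j i, (i, j) ∈ s → g (i, j) = 0 from fun p hp => H p.2 p.1 hp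
  intro j
  induction j using Nat.strong_induction_on with
  | _ j ih =>
    intro i hi
    obtain ⟨c, hc, hcj⟩ := exists_adjoint_pow_e_self hT hw j
    have key := congrArg (fun A : ellTwo →L[ℂ] ellTwo => inner ℂ (e i) (A (e j))) hg
    simp only [sum_apply, inner_sum, smul_apply,
      mul_apply_eq_comp, zero_apply, inner_zero_right,
      inner_smul_right] at key
    rw [Finset.sum_eq_single_of_mem (i, j) hi] at key
    · obtain ⟨d, hd, hdi⟩ := exists_pow_e_zero hT hw i
      simpa only [hcj, hdi, map_smul, inner_smul_right, inner_e_left_s5, e_apply, if_true, mul_one,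
        mul_eq_zero, hc, hd, or_false] using key
    · rintro ⟨i', j'⟩ hp hne
      rcases lt_trichotomy j' j with h | rfl | h
      · simp [ih j' h i' hp]
      · obtain ⟨d, -, hdi⟩ := exists_pow_e_zero hT hw i'
        have hii : i ≠ i' := by rintro rfl; exact hne rfl
        simp [hcj, hdi, inner_smul_right, inner_e_left_s5, e_apply, hii]
      · simp [adjoint_pow_e_of_lt hT h]

end WeightedShift

/-- The operators `T^i (T*)^j`, for `(i,j) ∈ ℕ × ℕ`, are linearly independent over ℂ:
the Fock representation of `Pol(ℂ)_q` is faithful. -/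
theorem stmt_5 (q : ℝ) (hq0 : 0 < q) (hq1 : q < 1)
    (T : ellTwo →L[ℂ] ellTwo)
    (hT : ∀ n : ℕ, T (e n) = (Real.sqrt (1 - q ^ (2 * (n + 1))) : ℂ) • e (n + 1)) :
    LinearIndependent ℂ
      (fun p : ℕ × ℕ => T ^ p.1 * (ContinuousLinearMap.adjoint T) ^ p.2) := by
  refine linearIndependent_pow_mul_adjoint_pow hT fun n => ?_
  have h : q ^ (2 * (n + 1)) < 1 := pow_lt_one₀ hq0.le hq1 (by omega)
  exact_mod_cast (Real.sqrt_pos.mpr (sub_pos.mpr h)).ne'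
end
end

section
/- Let H be a nonzero complex Hilbert space and S a bounded linear operator on H satisfying S* S = q² S S* + (1 - q²)·1. Assume the pair (S, S*) acts irreducibly (every closed subspace W of H with S(W) ⊆ W and S*(W) ⊆ W equals {0} or H) and that S S* ≠ 1 (equivalently, the representation does not factor through the unitary one-dimensional quotients, so it is faithful). Then there exists a unitary isomorphism U : ℓ²(ℕ, ℂ) → H (a linear isometric equivalence) such that S ∘ U = U ∘ T, where T is the Fock operator. (q-analogue of the Stone–von Neumann theorem, part 2 of Proposition 1.) -/
noncomputable section

open scoped InnerProductSpace Pointwise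

section QOscillator

variable {H : Type*} [NormedAddCommGroup H] [InnerProductSpace ℂ H] {q : ℝ} {S : H →L[ℂ] H}

/-- The normalised vectors `Sⁿ v / ‖Sⁿ v‖` built on a vacuum vector `v`. -/
def fockVector (q : ℝ) (S : H →L[ℂ] H) (v : H) : ℕ → H
  | 0 => v
  | n + 1 => ((Real.sqrt (1 - q ^ (2 * (n + 1))) : ℂ))⁻¹ • S (fockVector q S v n)

theorem sqrt_one_sub_pow_pos (hq0 : 0 < q) (hq1 : q < 1) (n : ℕ) :
    0 < Real.sqrt (1 - q ^ (2 * (n + 1))) :=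
  Real.sqrt_pos.2 (sub_pos.2 (pow_lt_one₀ hq0.le hq1 (by simp)))

theorem apply_fockVector (hq0 : 0 < q) (hq1 : q < 1) (v : H) (n : ℕ) :
    S (fockVector q S v n) =
      (Real.sqrt (1 - q ^ (2 * (n + 1))) : ℂ) • fockVector q S v (n + 1) := by
  rw [fockVector, smul_inv_smul₀]
  exact_mod_cast (sqrt_one_sub_pow_pos hq0 hq1 n).ne'

variable [CompleteSpace H]

/-- A selfadjoint element `a` of a C⋆-algebra with `a * u = c • (u * a)` for a unit `u` and a
scalar `c` with `‖c‖ < 1` vanishes: its spectral radius would be contracted by `‖c‖`. -/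
theorem IsSelfAdjoint.eq_zero_of_mul_unit_eq_smul {A : Type*} [CStarAlgebra A] {a u : A}
    (ha : IsSelfAdjoint a) (hu : IsUnit u) {c : ℂ} (hc : ‖c‖ < 1)
    (h : a * u = c • (u * a)) : a = 0 := by
  obtain ⟨u, rfl⟩ := hu
  have hconj : a = c • ((u : A) * a * (↑u⁻¹ : A)) := by
    rw [← smul_mul_assoc, ← h, mul_assoc, Units.mul_inv, mul_one]
  rcases eq_or_ne c 0 with rfl | hc0
  · rw [hconj, zero_smul]
  have hrad : spectralRadius ℂ a ≤ ‖c‖₊ * spectralRadius ℂ a := by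
    conv_lhs => rw [hconj]
    refine iSup₂_le fun k hk => ?_
    have hs : spectrum ℂ (Units.mk0 c hc0 • ((u : A) * a * (↑u⁻¹ : A))) =
        Units.mk0 c hc0 • spectrum ℂ a := by
      rw [spectrum.unit_smul_eq_smul, spectrum.units_conjugate]
    obtain ⟨l, hl, rfl⟩ := hs.subset hk
    have hl' : (‖l‖₊ : ENNReal) ≤ spectralRadius ℂ a :=
      le_iSup₂ (f := fun (k : ℂ) (_ : k ∈ spectrum ℂ a) => (‖k‖₊ : ENNReal)) l hl
    simpa [Units.smul_def] using mul_le_mul_right hl' (‖c‖₊ : ENNReal)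
  rw [ha.spectralRadius_eq_nnnorm] at hrad
  have hle : ‖a‖ ≤ ‖c‖ * ‖a‖ := by exact_mod_cast hrad
  have : ‖a‖ = 0 := by nlinarith [norm_nonneg a]
  exact norm_eq_zero.mp this

/-- A bounded operator on a Hilbert space that is bounded below and whose adjoint is injective is
invertible. -/
theorem ContinuousLinearMap.isUnit_of_antilipschitz_of_adjoint_injective
    {K : NNReal} (hK : AntilipschitzWith K S)
    (hinj : ∀ x, ContinuousLinearMap.adjoint S x = 0 → x = 0) : IsUnit S := by
  have hclosed : IsClosed (S.range : Set H) := hK.isClosed_range S.uniformContinuous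
  have hrange : S.range = ⊤ := by
    have := hclosed.completeSpace_coe
    rw [← Submodule.orthogonal_eq_bot_iff, ContinuousLinearMap.orthogonal_range]
    exact (Submodule.eq_bot_iff _).2 fun x hx => hinj x (by simpa using hx)
  rw [ContinuousLinearMap.isUnit_iff_bijective]
  exact ⟨hK.injective, LinearMap.range_eq_top.1 hrange⟩

/-- The commutation relation of the `q`-oscillator, pointwise. -/
theorem adjoint_apply_apply_of_qRelation
    (hS : ContinuousLinearMap.adjoint S * S =
      ((q : ℂ) ^ 2) • (S * ContinuousLinearMap.adjoint S) + (1 - (q : ℂ) ^ 2) • 1) (x : H) :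
    ContinuousLinearMap.adjoint S (S x) =
      (q : ℂ) ^ 2 • S (ContinuousLinearMap.adjoint S x) + (1 - (q : ℂ) ^ 2) • x := by
  simpa using DFunLike.congr_fun hS x

theorem sq_norm_le_sq_norm_apply_of_qRelation
    (hS : ContinuousLinearMap.adjoint S * S =
      ((q : ℂ) ^ 2) • (S * ContinuousLinearMap.adjoint S) + (1 - (q : ℂ) ^ 2) • 1) (x : H) :
    (1 - q ^ 2) * ‖x‖ ^ 2 ≤ ‖S x‖ ^ 2 := by
  have h : (‖S x‖ ^ 2 : ℂ) =
      (q : ℂ) ^ 2 * ‖ContinuousLinearMap.adjoint S x‖ ^ 2 + (1 - (q : ℂ) ^ 2) * ‖x‖ ^ 2 := by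
    simp only [← Complex.coe_algebraMap, ← inner_self_eq_norm_sq_to_K (𝕜 := ℂ)]
    rw [← ContinuousLinearMap.adjoint_inner_right, adjoint_apply_apply_of_qRelation hS,
      inner_add_right, inner_smul_right, inner_smul_right, ContinuousLinearMap.adjoint_inner_left]
    simp only [Complex.coe_algebraMap]
  have h' : ‖S x‖ ^ 2 =
      q ^ 2 * ‖ContinuousLinearMap.adjoint S x‖ ^ 2 + (1 - q ^ 2) * ‖x‖ ^ 2 := by
    exact_mod_cast h
  rw [h']
  exact le_add_of_nonneg_left (by positivity)

/-- Unless `S` is a coisometry, the `q`-oscillator relation forces a vacuum vector. -/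
theorem exists_norm_eq_one_adjoint_apply_eq_zero_of_qRelation (hq0 : 0 < q) (hq1 : q < 1)
    (hS : ContinuousLinearMap.adjoint S * S =
      ((q : ℂ) ^ 2) • (S * ContinuousLinearMap.adjoint S) + (1 - (q : ℂ) ^ 2) • 1)
    (hfaith : S * ContinuousLinearMap.adjoint S ≠ 1) :
    ∃ v : H, ‖v‖ = 1 ∧ ContinuousLinearMap.adjoint S v = 0 := by
  have hq2 : q ^ 2 < 1 := pow_lt_one₀ hq0.le hq1 two_ne_zero
  suffices h : ∃ x, ContinuousLinearMap.adjoint S x = 0 ∧ x ≠ 0 by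
    obtain ⟨x, hx, hx0⟩ := h
    exact ⟨(‖x‖⁻¹ : ℂ) • x, norm_smul_inv_norm hx0, by simp [hx]⟩
  by_contra! hinj
  have hpos : 0 < Real.sqrt (1 - q ^ 2) := Real.sqrt_pos.2 (by linarith)
  have hbound : AntilipschitzWith (Real.toNNReal (Real.sqrt (1 - q ^ 2))⁻¹) S := by
    refine ContinuousLinearMap.antilipschitz_of_bound S fun x => ?_
    rw [Real.coe_toNNReal _ (inv_nonneg.2 hpos.le), inv_mul_eq_div, le_div_iff₀ hpos]
    refine (sq_le_sq₀ (by positivity) (norm_nonneg _)).1 ?_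
    rw [mul_pow, Real.sq_sqrt (by linarith), mul_comm]
    exact sq_norm_le_sq_norm_apply_of_qRelation hS x
  have hunit := ContinuousLinearMap.isUnit_of_antilipschitz_of_adjoint_injective hbound hinj
  refine hfaith (sub_eq_zero.1 (IsSelfAdjoint.eq_zero_of_mul_unit_eq_smul
    (a := S * ContinuousLinearMap.adjoint S - 1) (c := (q : ℂ) ^ 2) ?_ hunit ?_ ?_))
  · rw [← ContinuousLinearMap.star_eq_adjoint]
    exact (IsSelfAdjoint.mul_star_self S).sub (IsSelfAdjoint.one _)
  · simpa [abs_of_pos hq0] using hq2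
  · ext x
    simp only [mul_apply_eq_comp, sub_apply, one_apply_eq_self, smul_apply, map_sub,
      adjoint_apply_apply_of_qRelation hS, map_add, map_smul]
    module

theorem apply_adjoint_apply_fockVector
    (hS : ContinuousLinearMap.adjoint S * S =
      ((q : ℂ) ^ 2) • (S * ContinuousLinearMap.adjoint S) + (1 - (q : ℂ) ^ 2) • 1)
    {v : H} (hv : ContinuousLinearMap.adjoint S v = 0) (n : ℕ) :
    S (ContinuousLinearMap.adjoint S (fockVector q S v n)) =
      (1 - (q : ℂ) ^ (2 * n)) • fockVector q S v n := by
  induction n with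
  | zero => simp [fockVector, hv]
  | succ n ih =>
    simp only [fockVector, map_smul, adjoint_apply_apply_of_qRelation hS, ih, map_add]
    module

theorem adjoint_apply_apply_fockVector
    (hS : ContinuousLinearMap.adjoint S * S =
      ((q : ℂ) ^ 2) • (S * ContinuousLinearMap.adjoint S) + (1 - (q : ℂ) ^ 2) • 1)
    {v : H} (hv : ContinuousLinearMap.adjoint S v = 0) (n : ℕ) :
    ContinuousLinearMap.adjoint S (S (fockVector q S v n)) =
      (1 - (q : ℂ) ^ (2 * (n + 1))) • fockVector q S v n := by
  rw [adjoint_apply_apply_of_qRelation hS, apply_adjoint_apply_fockVector hS hv]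
  module

theorem adjoint_apply_fockVector_succ
    (hS : ContinuousLinearMap.adjoint S * S =
      ((q : ℂ) ^ 2) • (S * ContinuousLinearMap.adjoint S) + (1 - (q : ℂ) ^ 2) • 1)
    {v : H} (hv : ContinuousLinearMap.adjoint S v = 0) (n : ℕ) :
    ContinuousLinearMap.adjoint S (fockVector q S v (n + 1)) =
      ((Real.sqrt (1 - q ^ (2 * (n + 1))) : ℂ)⁻¹ * (1 - (q : ℂ) ^ (2 * (n + 1)))) •
        fockVector q S v n := by
  rw [fockVector, map_smul, adjoint_apply_apply_fockVector hS hv, smul_smul]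

theorem norm_fockVector (hq0 : 0 < q) (hq1 : q < 1)
    (hS : ContinuousLinearMap.adjoint S * S =
      ((q : ℂ) ^ 2) • (S * ContinuousLinearMap.adjoint S) + (1 - (q : ℂ) ^ 2) • 1)
    {v : H} (hv1 : ‖v‖ = 1) (hv : ContinuousLinearMap.adjoint S v = 0) (n : ℕ) :
    ‖fockVector q S v n‖ = 1 := by
  induction n with
  | zero => exact hv1
  | succ n ih =>
    have hpos := sqrt_one_sub_pow_pos hq0 hq1 n
    have h : (‖S (fockVector q S v n)‖ ^ 2 : ℂ) = 1 - (q : ℂ) ^ (2 * (n + 1)) := by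
      rw [← Complex.coe_algebraMap, ← inner_self_eq_norm_sq_to_K (𝕜 := ℂ),
        ← ContinuousLinearMap.adjoint_inner_right, adjoint_apply_apply_fockVector hS hv,
        inner_smul_right, inner_self_eq_norm_sq_to_K, ih]
      simp
    have h' : ‖S (fockVector q S v n)‖ ^ 2 = 1 - q ^ (2 * (n + 1)) := by exact_mod_cast h
    have hnorm : ‖S (fockVector q S v n)‖ = Real.sqrt (1 - q ^ (2 * (n + 1))) := by
      rw [← h', Real.sqrt_sq (norm_nonneg _)]
    rw [fockVector, norm_smul, norm_inv, hnorm, Complex.norm_real, Real.norm_of_nonneg hpos.le,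
      inv_mul_cancel₀ hpos.ne']

theorem orthonormal_fockVector (hq0 : 0 < q) (hq1 : q < 1)
    (hS : ContinuousLinearMap.adjoint S * S =
      ((q : ℂ) ^ 2) • (S * ContinuousLinearMap.adjoint S) + (1 - (q : ℂ) ^ 2) • 1)
    {v : H} (hv1 : ‖v‖ = 1) (hv : ContinuousLinearMap.adjoint S v = 0) :
    Orthonormal ℂ (fockVector q S v) := by
  refine ⟨norm_fockVector hq0 hq1 hS hv1 hv, fun m n hmn => ?_⟩
  have h : ⟪S (ContinuousLinearMap.adjoint S (fockVector q S v m)), fockVector q S v n⟫_ℂ =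
      ⟪fockVector q S v m, S (ContinuousLinearMap.adjoint S (fockVector q S v n))⟫_ℂ := by
    rw [← ContinuousLinearMap.adjoint_inner_right, ContinuousLinearMap.adjoint_inner_left]
  rw [apply_adjoint_apply_fockVector hS hv, apply_adjoint_apply_fockVector hS hv,
    inner_smul_left, inner_smul_right] at h
  simp only [map_sub, map_one, map_pow, Complex.conj_ofReal] at h
  refine (mul_eq_mul_right_iff.1 h).resolve_left fun heq => hmn ?_
  have hpow : q ^ (2 * m) = q ^ (2 * n) := by exact_mod_cast sub_right_injective heq
  have := pow_right_injective₀ hq0 hq1.ne hpow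
  lia

end QOscillator

theorem Submodule.apply_mem_topologicalClosure_span {H : Type*} [NormedAddCommGroup H]
    [NormedSpace ℂ H] (S : H →L[ℂ] H) {s : Set H}
    (h : ∀ x ∈ s, S x ∈ Submodule.span ℂ s) :
    ∀ x ∈ (Submodule.span ℂ s).topologicalClosure,
      S x ∈ (Submodule.span ℂ s).topologicalClosure := by
  have hle : Submodule.span ℂ s ≤ (Submodule.span ℂ s).comap S.toLinearMap :=
    Submodule.span_le.2 h
  exact fun x hx => map_mem_closure S.continuous hx fun y hy => hle hy

/-- q-analogue of the Stone–von Neumann theorem: every faithful irreducible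
`*`-representation of `Pol(ℂ)_q` is unitarily equivalent to the Fock representation. -/
theorem stmt_6 (q : ℝ) (hq0 : 0 < q) (hq1 : q < 1)
    (T : ellTwo →L[ℂ] ellTwo)
    (hT : ∀ n : ℕ, T (e n) = (Real.sqrt (1 - q ^ (2 * (n + 1))) : ℂ) • e (n + 1))
    (H : Type*) [NormedAddCommGroup H] [InnerProductSpace ℂ H] [CompleteSpace H]
    [Nontrivial H]
    (S : H →L[ℂ] H)
    (hS : ContinuousLinearMap.adjoint S * S =
      ((q : ℂ) ^ 2) • (S * ContinuousLinearMap.adjoint S) + (1 - (q : ℂ) ^ 2) • 1)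
    (hirr : ∀ W : Submodule ℂ H, IsClosed (W : Set H) →
      (∀ x ∈ W, S x ∈ W) → (∀ x ∈ W, ContinuousLinearMap.adjoint S x ∈ W) →
      W = ⊥ ∨ W = ⊤)
    (hfaith : S * ContinuousLinearMap.adjoint S ≠ 1) :
    ∃ U : ellTwo ≃ₗᵢ[ℂ] H, ∀ x : ellTwo, S (U x) = U (T x) := by
  obtain ⟨v, hv1, hv⟩ := exists_norm_eq_one_adjoint_apply_eq_zero_of_qRelation hq0 hq1 hS hfaith
  have hortho := orthonormal_fockVector hq0 hq1 hS hv1 hv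
  have hmem (n : ℕ) : fockVector q S v n ∈ Submodule.span ℂ (Set.range (fockVector q S v)) :=
    Submodule.subset_span ⟨n, rfl⟩
  have hspan : (Submodule.span ℂ (Set.range (fockVector q S v))).topologicalClosure = ⊤ := by
    refine (hirr _ (Submodule.isClosed_topologicalClosure _)
      (Submodule.apply_mem_topologicalClosure_span S ?_)
      (Submodule.apply_mem_topologicalClosure_span (ContinuousLinearMap.adjoint S) ?_)).resolve_left
      fun hbot => ?_
    · rintro _ ⟨n, rfl⟩
      rw [apply_fockVector hq0 hq1]
      exact Submodule.smul_mem _ _ (hmem _)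
    · rintro _ ⟨_ | n, rfl⟩
      · simp [fockVector, hv]
      · rw [adjoint_apply_fockVector_succ hS hv]
        exact Submodule.smul_mem _ _ (hmem _)
    · have h0 := Submodule.le_topologicalClosure _ (hmem 0)
      rw [hbot, Submodule.mem_bot] at h0
      exact hortho.ne_zero 0 h0
  let b : HilbertBasis ℕ ℂ H := HilbertBasis.mk hortho hspan.ge
  have hb (n : ℕ) : b.repr.symm (e n) = fockVector q S v n := by
    rw [e, HilbertBasis.repr_symm_single, HilbertBasis.coe_mk]
  have hb' (n : ℕ) : b.repr (fockVector q S v n) = e n := by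
    rw [← hb, LinearIsometryEquiv.apply_symm_apply]
  have hST : S = (b.repr.symm.toContinuousLinearEquiv : ellTwo →L[ℂ] H) ∘L T ∘L
      (b.repr.toContinuousLinearEquiv : H →L[ℂ] ellTwo) := by
    refine ContinuousLinearMap.ext_on
      (Submodule.dense_iff_topologicalClosure_eq_top.2 hspan) ?_
    rintro _ ⟨n, rfl⟩
    simp [hb', hT, hb, apply_fockVector hq0 hq1]
  exact ⟨b.repr.symm, fun x => by simpa using DFunLike.congr_fun hST (b.repr.symm x)⟩
end
end

section
/- Let H be a nonzero complex Hilbert space and S a bounded linear operator on H satisfying S* S = q² S S* + (1 - q²)·1 and S S* = 1. If the pair (S, S*) acts irreducibly (every closed subspace W of H with S(W) ⊆ W and S*(W) ⊆ W equals {0} or H), then H is one-dimensional. (These one-dimensional representations, together with the Fock representation, exhaust the irreducible *-representations of Pol(ℂ)_q; in particular the coisometric ones are not faithful.) -/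
/-- A continuous function that does not vanish at some point of the spectrum is nonzero in the
functional calculus. -/
theorem cfc_ne_zero_of_mem_spectrum {A : Type*} [CStarAlgebra A] [Nontrivial A] {a : A}
    [IsStarNormal a] {f : ℂ → ℂ} (hf : Continuous f) {z : ℂ} (hz : z ∈ spectrum ℂ a)
    (hfz : f z ≠ 0) : cfc f a ≠ 0 := by
  intro h
  have hmem : f z ∈ spectrum ℂ (cfc f a) := by
    rw [cfc_map_spectrum f a (hf := hf.continuousOn)]
    exact ⟨z, hz, rfl⟩
  rw [h, spectrum.zero_eq] at hmem
  exact hfz hmem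

/-- Distinct complex numbers are separated by continuous functions with product zero. -/
theorem exists_continuous_mul_eq_zero {a b : ℂ} (hab : a ≠ b) :
    ∃ f g : ℂ → ℂ, Continuous f ∧ Continuous g ∧ f a ≠ 0 ∧ g b ≠ 0 ∧ ∀ z, f z * g z = 0 := by
  refine ⟨fun z => (max 0 (dist a b / 2 - dist z a) : ℝ),
    fun z => (max 0 (dist a b / 2 - dist z b) : ℝ), by fun_prop, by fun_prop, ?_, ?_, ?_⟩
  · simp [hab]
  · simp [hab]
  · intro z
    have h := dist_triangle_left a b z
    rcases le_total (dist a b / 2) (dist z a) with h' | h'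
    · simp [max_eq_left (sub_nonpos.2 h')]
    · have h'' : dist a b / 2 ≤ dist z b := by linarith
      simp [max_eq_left (sub_nonpos.2 h'')]

section Irreducible

variable {H : Type*} [NormedAddCommGroup H] [InnerProductSpace ℂ H] [CompleteSpace H]
  [Nontrivial H]

/-- The spectrum of an irreducible normal operator has at most one point. -/
theorem spectrum_subsingleton_of_irreducible (S : H →L[ℂ] H) [IsStarNormal S]
    (hirr : ∀ W : Submodule ℂ H, IsClosed (W : Set H) →
      (∀ x ∈ W, S x ∈ W) → (∀ x ∈ W, ContinuousLinearMap.adjoint S x ∈ W) →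
      W = ⊥ ∨ W = ⊤) :
    (spectrum ℂ S).Subsingleton := by
  intro a ha b hb
  by_contra hab
  obtain ⟨f, g, hf, hg, hfa, hgb, hfg⟩ := exists_continuous_mul_eq_zero hab
  have hF := cfc_ne_zero_of_mem_spectrum hf ha hfa
  have hG := cfc_ne_zero_of_mem_spectrum hg hb hgb
  have hFG : cfc f S * cfc g S = 0 := by
    rw [← cfc_mul f g S hf.continuousOn hg.continuousOn]
    simp [hfg]
  have hcS : Commute (cfc f S) S := by
    simpa only [cfc_id ℂ S] using cfc_commute_cfc f id S
  have hcS' : Commute (cfc f S) (ContinuousLinearMap.adjoint S) := by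
    have h := cfc_commute_cfc f (fun z => star z) S
    rwa [cfc_star_id (a := S)] at h
  have hker : ∀ T : H →L[ℂ] H, Commute (cfc f S) T →
      ∀ x ∈ (cfc f S).ker, T x ∈ (cfc f S).ker := by
    intro T hT x hx
    have hx' : cfc f S x = 0 := hx
    have h := DFunLike.congr_fun hT.eq x
    simp only [mul_apply_eq_comp, hx', map_zero] at h
    exact h
  rcases hirr (cfc f S).ker (cfc f S).isClosed_ker (hker _ hcS) (hker _ hcS') with h | h
  · refine hG (ContinuousLinearMap.ext fun x => ?_)
    have hx : cfc g S x ∈ (cfc f S).ker := DFunLike.congr_fun hFG x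
    rw [h] at hx
    exact hx
  · refine hF (ContinuousLinearMap.ext fun x => ?_)
    have hx : x ∈ (cfc f S).ker := h ▸ Submodule.mem_top
    exact hx

/-- An irreducible normal operator acts on a one-dimensional space. -/
theorem finrank_eq_one_of_irreducible (S : H →L[ℂ] H) [IsStarNormal S]
    (hirr : ∀ W : Submodule ℂ H, IsClosed (W : Set H) →
      (∀ x ∈ W, S x ∈ W) → (∀ x ∈ W, ContinuousLinearMap.adjoint S x ∈ W) →
      W = ⊥ ∨ W = ⊤) :
    Module.finrank ℂ H = 1 := by
  have hsub := spectrum_subsingleton_of_irreducible S hirr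
  obtain ⟨c, hc⟩ := spectrum.nonempty S
  have hS : S = c • 1 := by
    have h : cfc (id : ℂ → ℂ) S = cfc (fun _ => c) S := cfc_congr fun z hz => hsub hz hc
    rw [cfc_id ℂ S, cfc_const c S] at h
    rw [h, Algebra.algebraMap_eq_smul_one]
  obtain ⟨v, hv⟩ := exists_ne (0 : H)
  have hSt : ContinuousLinearMap.adjoint S = star c • 1 := by
    rw [hS, ← ContinuousLinearMap.star_eq_adjoint, star_smul, star_one]
  rcases hirr (ℂ ∙ v) (Submodule.closed_of_finiteDimensional _)
    (fun x hx => by rw [hS]; exact Submodule.smul_mem _ c hx)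
    (fun x hx => by rw [hSt]; exact Submodule.smul_mem _ (star c) hx) with h | h
  · exact absurd (Submodule.span_singleton_eq_bot.1 h) hv
  · rw [← finrank_top, ← h, finrank_span_singleton hv]

end Irreducible

/-- An irreducible `*`-representation of `Pol(ℂ)_q` with `S S* = 1` (a coisometric,
non-faithful one) is one-dimensional. -/
theorem stmt_7 (q : ℝ) (hq0 : 0 < q) (hq1 : q < 1)
    (H : Type*) [NormedAddCommGroup H] [InnerProductSpace ℂ H] [CompleteSpace H]
    [Nontrivial H]
    (S : H →L[ℂ] H)
    (hS : ContinuousLinearMap.adjoint S * S =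
      ((q : ℂ) ^ 2) • (S * ContinuousLinearMap.adjoint S) + (1 - (q : ℂ) ^ 2) • 1)
    (hcoiso : S * ContinuousLinearMap.adjoint S = 1)
    (hirr : ∀ W : Submodule ℂ H, IsClosed (W : Set H) →
      (∀ x ∈ W, S x ∈ W) → (∀ x ∈ W, ContinuousLinearMap.adjoint S x ∈ W) →
      W = ⊥ ∨ W = ⊤) :
    Module.finrank ℂ H = 1 := by
  have hiso : ContinuousLinearMap.adjoint S * S = 1 := by
    rw [hS, hcoiso, ← add_smul, add_sub_cancel, one_smul]
  have : IsStarNormal S := ⟨by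
    rw [ContinuousLinearMap.star_eq_adjoint, commute_iff_eq, hiso, hcoiso]⟩
  exact finrank_eq_one_of_irreducible S hirr
end

section
/- Let H be a nonzero complex Hilbert space and S a bounded linear operator on H satisfying S* S = q² S S* + (1 - q²)·1. Assume the pair (S, S*) acts irreducibly (every closed subspace W of H with S(W) ⊆ W and S*(W) ⊆ W equals {0} or H) and that S S* ≠ 1. Then there exists a nonzero vector v ∈ H with S* v = 0 (a vacuum vector). -/
/-- A self-adjoint element of a C⋆-algebra which is conjugate to `c` times itself, for a real
`c` with `|c| ≠ 1`, vanishes. -/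
theorem IsSelfAdjoint.eq_zero_of_units_conjugate {A : Type*} [CStarAlgebra A] {d : A}
    (hd : IsSelfAdjoint d) {c : ℝ} (hc : |c| ≠ 1) (u : Aˣ)
    (h : (u : A) * d * (↑u⁻¹ : A) = (c : ℂ) • d) : d = 0 := by
  have hcd : IsSelfAdjoint ((c : ℂ) • d) :=
    IsSelfAdjoint.smul (by simp [isSelfAdjoint_iff]) hd
  have hr : spectralRadius ℂ ((c : ℂ) • d) = spectralRadius ℂ d := by
    rw [← h, spectralRadius, spectralRadius, spectrum.units_conjugate]
  rw [hcd.spectralRadius_eq_nnnorm, hd.spectralRadius_eq_nnnorm, ENNReal.coe_inj] at hr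
  have hn : |c| * ‖d‖ = ‖d‖ := by
    simpa [norm_smul] using congrArg ((↑) : NNReal → ℝ) hr
  by_contra hd0
  exact hc (mul_right_cancel₀ (norm_ne_zero_iff.mpr hd0) (by rw [hn, one_mul]))

/-- An element `s` of a C⋆-algebra with `s* s = c s s* + (1 - c)`, for a real `c` with `|c| ≠ 1`,
is unitary as soon as `s*` is invertible. -/
theorem mul_star_eq_one_of_isUnit_star {A : Type*} [CStarAlgebra A] {s : A} {c : ℝ}
    (hc : |c| ≠ 1) (hs : star s * s = (c : ℂ) • (s * star s) + (1 - (c : ℂ)) • 1)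
    (hu : IsUnit (star s)) : s * star s = 1 := by
  obtain ⟨u, hu⟩ := hu
  have hsa : IsSelfAdjoint (1 - s * star s) :=
    (IsSelfAdjoint.one _).sub (IsSelfAdjoint.mul_star_self s)
  have hcomm : star s * (1 - s * star s) = ((c : ℂ) • (1 - s * star s)) * star s := by
    rw [mul_sub, ← mul_assoc, hs]
    simp only [smul_sub, sub_mul, add_mul, smul_mul_assoc, one_mul, mul_one, sub_smul, one_smul]
    abel
  refine (sub_eq_zero.mp (hsa.eq_zero_of_units_conjugate hc u ?_)).symm
  rw [Units.mul_inv_eq_iff_eq_mul, hu, hcomm]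

/-- If `S* S = q² S S* + (1 - q²)` with `q² < 1`, then `S* S` is invertible. -/
theorem isUnit_adjoint_mul_self_of_qDisc {q : ℝ} (hq : q ^ 2 < 1)
    {H : Type*} [NormedAddCommGroup H] [InnerProductSpace ℂ H] [CompleteSpace H]
    {S : H →L[ℂ] H}
    (hS : ContinuousLinearMap.adjoint S * S =
      ((q : ℂ) ^ 2) • (S * ContinuousLinearMap.adjoint S) + (1 - (q : ℂ) ^ 2) • 1) :
    IsUnit (ContinuousLinearMap.adjoint S * S) := by
  refine ContinuousLinearMap.isUnit_of_forall_le_norm_inner_map _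
    (c := (1 - q ^ 2).toNNReal) (by simpa using hq) fun x => ?_
  have key : inner ℂ ((ContinuousLinearMap.adjoint S * S) x) x =
      ((q ^ 2 * ‖ContinuousLinearMap.adjoint S x‖ ^ 2 + (1 - q ^ 2) * ‖x‖ ^ 2 : ℝ) : ℂ) := by
    rw [hS]
    have h1 : inner ℂ (S (ContinuousLinearMap.adjoint S x)) x =
        ((‖ContinuousLinearMap.adjoint S x‖ ^ 2 : ℝ) : ℂ) := by
      rw [← ContinuousLinearMap.adjoint_inner_right, inner_self_eq_norm_sq_to_K]
      simp
    simp [h1]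
    ring
  rw [key, Complex.norm_real, Real.norm_eq_abs]
  refine le_trans ?_ (le_abs_self _)
  rw [Real.coe_toNNReal _ (by linarith)]
  nlinarith [mul_nonneg (sq_nonneg q) (sq_nonneg ‖ContinuousLinearMap.adjoint S x‖)]

/-- Every faithful irreducible `*`-representation of `Pol(ℂ)_q` possesses a vacuum vector:
a nonzero vector annihilated by `S*`. -/
theorem stmt_8 (q : ℝ) (hq0 : 0 < q) (hq1 : q < 1)
    (H : Type*) [NormedAddCommGroup H] [InnerProductSpace ℂ H] [CompleteSpace H]
    [Nontrivial H]
    (S : H →L[ℂ] H)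
    (hS : ContinuousLinearMap.adjoint S * S =
      ((q : ℂ) ^ 2) • (S * ContinuousLinearMap.adjoint S) + (1 - (q : ℂ) ^ 2) • 1)
    (hirr : ∀ W : Submodule ℂ H, IsClosed (W : Set H) →
      (∀ x ∈ W, S x ∈ W) → (∀ x ∈ W, ContinuousLinearMap.adjoint S x ∈ W) →
      W = ⊥ ∨ W = ⊤)
    (hfaith : S * ContinuousLinearMap.adjoint S ≠ 1) :
    ∃ v : H, v ≠ 0 ∧ ContinuousLinearMap.adjoint S v = 0 := by
  by_contra! hker
  have hq : q ^ 2 < 1 := by nlinarith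
  have hc : |q ^ 2| ≠ 1 := by
    rw [abs_of_nonneg (sq_nonneg q)]
    exact hq.ne
  obtain ⟨w, hw⟩ := isUnit_adjoint_mul_self_of_qDisc hq hS
  have hright : ContinuousLinearMap.adjoint S * (S * ↑w⁻¹) = 1 := by
    rw [← mul_assoc, ← hw, Units.mul_inv]
  have hunit : IsUnit (ContinuousLinearMap.adjoint S) := by
    rw [ContinuousLinearMap.isUnit_iff_bijective]
    refine ⟨(injective_iff_map_eq_zero _).mpr fun x hx => ?_, fun y => ⟨(S * ↑w⁻¹) y, ?_⟩⟩
    · by_contra hne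
      exact hker x hne hx
    · exact congrArg (fun f : H →L[ℂ] H => f y) hright
  refine hfaith (mul_star_eq_one_of_isUnit_star hc ?_ hunit)
  rw [Complex.ofReal_pow]
  exact hS
end

section
/- The spectrum of the positive bounded operator T T* on ℓ²(ℕ, ℂ) equals the set {1 - q^{2n} : n ∈ ℕ} ∪ {1}, where T is the Fock operator and T* its adjoint. -/
noncomputable section

/-- An operator that is diagonal on the standard basis acts coordinatewise. -/
theorem diagonal_apply {A : ellTwo →L[ℂ] ellTwo} {d : ℕ → ℂ}
    (hA : ∀ n, A (e n) = d n • e n) (f : ellTwo) (n : ℕ) : A f n = d n * f n := by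
  suffices h : (lp.evalCLM ℂ (fun _ : ℕ => ℂ) 2 n).comp A =
      d n • lp.evalCLM ℂ (fun _ : ℕ => ℂ) 2 n from DFunLike.congr_fun h f
  refine lp.ext_continuousLinearMap (by norm_num) fun i => ?_
  ext
  change A (e i) n = d n * e i n
  rw [hA]
  by_cases h : n = i
  · subst h; simp
  · simp [e, h]

/-- The spectrum of a diagonal operator is the closure of its set of diagonal entries. -/
theorem spectrum_diagonal_operator {A : ellTwo →L[ℂ] ellTwo} {d : ℕ → ℂ}
    (hA : ∀ n, A (e n) = d n • e n) : spectrum ℂ A = closure (Set.range d) := by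
  apply Set.Subset.antisymm
  · intro μ hμ
    by_contra hcl
    obtain ⟨ε, hε, hd⟩ : ∃ ε > 0, ∀ n, ε ≤ ‖μ - d n‖ := by
      simpa [Metric.mem_closure_iff, dist_eq_norm] using hcl
    have hne (n : ℕ) : μ - d n ≠ 0 := norm_pos_iff.1 (hε.trans_le (hd n))
    have happ (f : ellTwo) (n : ℕ) :
        (algebraMap ℂ (ellTwo →L[ℂ] ellTwo) μ - A) f n = (μ - d n) * f n := by
      rw [sub_mul, ← diagonal_apply hA, Algebra.algebraMap_eq_smul_one]
      rfl
    refine hμ (ContinuousLinearMap.isUnit_iff_bijective.2 ⟨fun f g hfg => ?_, fun g => ?_⟩)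
    · ext n
      have := congrArg (fun h : ellTwo => h n) hfg
      simp only [happ] at this
      exact mul_left_cancel₀ (hne n) this
    · have hmem : Memℓp (fun n => (μ - d n)⁻¹ * g n) 2 := by
        refine ((lp.memℓp g).const_smul (ε⁻¹ : ℂ)).mono' fun n => ?_
        rw [Pi.smul_apply, norm_mul, norm_smul, norm_inv, norm_inv, Complex.norm_real,
          Real.norm_of_nonneg hε.le]
        gcongr
        exact hd n
      refine ⟨⟨_, hmem⟩, ?_⟩
      ext n
      rw [happ]
      exact mul_inv_cancel_left₀ (hne n) _
  · refine closure_minimal ?_ (spectrum.isClosed A)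
    rintro _ ⟨n, rfl⟩ hu
    have hzero : e n = 0 := (ContinuousLinearMap.isUnit_iff_bijective.1 hu).1 (by
      simp [Algebra.algebraMap_eq_smul_one, hA])
    simpa [e] using congrArg (fun h : ellTwo => h n) hzero

/-- The Fock operator composed with its adjoint is diagonal. -/
theorem fock_mul_adjoint_apply {q : ℝ} (hq0 : 0 < q) (hq1 : q < 1) {T : ellTwo →L[ℂ] ellTwo}
    (hT : ∀ n : ℕ, T (e n) = (Real.sqrt (1 - q ^ (2 * (n + 1))) : ℂ) • e (n + 1)) (n : ℕ) :
    (T * ContinuousLinearMap.adjoint T) (e n) = (1 - (q : ℂ) ^ (2 * n)) • e n := by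
  have hcoord (m : ℕ) : ContinuousLinearMap.adjoint T (e n) m =
      (Real.sqrt (1 - q ^ (2 * (m + 1))) : ℂ) * e n (m + 1) := by
    have h := ContinuousLinearMap.adjoint_inner_right T (e m) (e n)
    rw [hT, inner_smul_left] at h
    simpa [e, lp.inner_single_left] using h
  cases n with
  | zero =>
    have : ContinuousLinearMap.adjoint T (e 0) = 0 := by
      ext m
      rw [hcoord]
      simp [e]
    simp [this]
  | succ n =>
    have : ContinuousLinearMap.adjoint T (e (n + 1)) =
        (Real.sqrt (1 - q ^ (2 * (n + 1))) : ℂ) • e n := by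
      ext m
      rw [hcoord]
      by_cases h : m = n
      · subst h; simp [e, -Complex.coe_smul]
      · simp [e, h, -Complex.coe_smul]
    have hnn : 0 ≤ 1 - q ^ (2 * (n + 1)) := sub_nonneg.2 (pow_le_one₀ hq0.le hq1.le)
    rw [mul_apply_eq_comp, this, map_smul, hT, smul_smul, ← Complex.ofReal_mul,
      Real.mul_self_sqrt hnn]
    simp

/-- The spectrum of `T T*` equals `{1 - q^{2n} : n ∈ ℕ} ∪ {1}`. -/
theorem stmt_9 (q : ℝ) (hq0 : 0 < q) (hq1 : q < 1)
    (T : ellTwo →L[ℂ] ellTwo)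
    (hT : ∀ n : ℕ, T (e n) = (Real.sqrt (1 - q ^ (2 * (n + 1))) : ℂ) • e (n + 1)) :
    spectrum ℂ (T * ContinuousLinearMap.adjoint T) =
      (Set.range fun n : ℕ => 1 - (q : ℂ) ^ (2 * n)) ∪ {1} := by
  have hlim : Filter.Tendsto (fun n : ℕ => 1 - (q : ℂ) ^ (2 * n)) Filter.atTop (nhds 1) := by
    have hq : ‖(q : ℂ) ^ 2‖ < 1 := by
      rw [norm_pow, Complex.norm_real, Real.norm_of_nonneg hq0.le]
      exact pow_lt_one₀ hq0.le hq1 two_ne_zero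
    simpa [pow_mul] using (tendsto_pow_atTop_nhds_zero_of_norm_lt_one hq).const_sub 1
  rw [spectrum_diagonal_operator (fock_mul_adjoint_apply hq0 hq1 hT), Set.union_singleton]
  refine (closure_minimal (Set.subset_insert _ _) hlim.isCompact_insert_range.isClosed).antisymm
    (Set.insert_subset ?_ subset_closure)
  exact mem_closure_of_tendsto hlim (Filter.Eventually.of_forall Set.mem_range_self)
end
end

section
/- The ℂ-linear operators K, K⁻¹, E, F on the Laurent polynomial ring ℂ[z, z⁻¹] defined on monomials (for all n ∈ ℤ) by K(zⁿ) = q^{2n} zⁿ, K⁻¹(zⁿ) = q^{-2n} zⁿ, F(zⁿ) = q^{1/2} · ((q^{-2n} − 1)/(q^{-2} − 1)) · z^{n-1}, and E(zⁿ) = −q^{1/2} · ((1 − q^{2n})/(1 − q²)) · z^{n+1}, satisfy the U_q(sl₂) relations: K ∘ K⁻¹ = K⁻¹ ∘ K = id, K ∘ E = q² · (E ∘ K), K ∘ F = q⁻² · (F ∘ K), and E ∘ F − F ∘ E = (q − q⁻¹)⁻¹ · (K − K⁻¹). -/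
open LaurentPolynomial

/-- Two linear maps out of the Laurent polynomials agree if they agree on all monomials `T n`. -/
theorem LaurentPolynomial.linearMap_ext {R M : Type*} [CommSemiring R] [AddCommMonoid M]
    [Module R M] {f g : LaurentPolynomial R →ₗ[R] M} (h : ∀ n : ℤ, f (T n) = g (T n)) :
    f = g := by
  refine LinearMap.ext fun p => ?_
  induction p using LaurentPolynomial.induction_on' with
  | add p r hp hr => rw [map_add, map_add, hp, hr]
  | C_mul_T n a => rw [← LaurentPolynomial.smul_eq_C_mul, map_smul, map_smul, h]

/-- The q-difference operators `K, K⁻¹, E, F` on the Laurent polynomial ring `ℂ[z, z⁻¹]`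
(given on monomials `zⁿ = T n`, `n ∈ ℤ`, by `K zⁿ = q^{2n} zⁿ`, `K⁻¹ zⁿ = q^{-2n} zⁿ`,
`F zⁿ = q^{1/2}·(q^{-2n}-1)/(q^{-2}-1)·z^{n-1}`,
`E zⁿ = -q^{1/2}·(1-q^{2n})/(1-q²)·z^{n+1}`) satisfy the `U_q(sl₂)` relations. -/
theorem stmt_13 (q : ℝ) (hq0 : 0 < q) (hq1 : q < 1)
    (K Kinv E F : LaurentPolynomial ℂ →ₗ[ℂ] LaurentPolynomial ℂ)
    (hK : ∀ n : ℤ, K (T n) = ((q : ℂ) ^ (2 * n)) • T n)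
    (hKinv : ∀ n : ℤ, Kinv (T n) = ((q : ℂ) ^ (-(2 * n))) • T n)
    (hF : ∀ n : ℤ, F (T n) =
      ((Real.sqrt q : ℂ) * (((q : ℂ) ^ (-(2 * n)) - 1) / ((q : ℂ) ^ (-2 : ℤ) - 1))) •
        T (n - 1))
    (hE : ∀ n : ℤ, E (T n) =
      (-(Real.sqrt q : ℂ) * ((1 - (q : ℂ) ^ (2 * n)) / (1 - (q : ℂ) ^ 2))) • T (n + 1)) :
    K ∘ₗ Kinv = LinearMap.id ∧
    Kinv ∘ₗ K = LinearMap.id ∧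
    K ∘ₗ E = ((q : ℂ) ^ 2) • (E ∘ₗ K) ∧
    K ∘ₗ F = ((q : ℂ) ^ 2)⁻¹ • (F ∘ₗ K) ∧
    E ∘ₗ F - F ∘ₗ E = ((q : ℂ) - (q : ℂ)⁻¹)⁻¹ • (K - Kinv) := by
  have hqC : (q : ℂ) ≠ 0 := by exact_mod_cast hq0.ne'
  have hsq : (1 : ℂ) - (q : ℂ) ^ 2 ≠ 0 := by
    have h : (1 : ℝ) - q ^ 2 ≠ 0 := by nlinarith
    exact_mod_cast h
  have hsqrt : (Real.sqrt q : ℂ) * (Real.sqrt q : ℂ) = q := by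
    exact_mod_cast Real.mul_self_sqrt hq0.le
  have hshift (n : ℤ) : (q : ℂ) ^ (2 * (n + 1)) = (q : ℂ) ^ (2 * n) * (q : ℂ) ^ 2 := by
    rw [mul_add, zpow_add₀ hqC]
    norm_cast
  have hunshift (n : ℤ) : (q : ℂ) ^ (2 * (n - 1)) = (q : ℂ) ^ (2 * n) * ((q : ℂ) ^ 2)⁻¹ := by
    rw [mul_sub, zpow_sub₀ hqC, div_eq_mul_inv]
    norm_cast
  have hne (n : ℤ) : (q : ℂ) ^ (2 * n) ≠ 0 := zpow_ne_zero _ hqC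
  have hneg_two : (q : ℂ) ^ (-2 : ℤ) = ((q : ℂ) ^ 2)⁻¹ := by
    rw [zpow_neg]
    norm_cast
  have hinv : ((q : ℂ) ^ 2)⁻¹ - 1 ≠ 0 := by
    have h : ((q : ℂ) ^ 2)⁻¹ - 1 = (1 - (q : ℂ) ^ 2) * ((q : ℂ) ^ 2)⁻¹ := by field_simp
    rw [h]
    exact mul_ne_zero hsq (inv_ne_zero (pow_ne_zero 2 hqC))
  have hqinv : (q : ℂ) - (q : ℂ)⁻¹ ≠ 0 := by
    have h : (q : ℂ) - (q : ℂ)⁻¹ = -(1 - (q : ℂ) ^ 2) * (q : ℂ)⁻¹ := by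
      field_simp
      ring
    rw [h]
    exact mul_ne_zero (neg_ne_zero.mpr hsq) (inv_ne_zero hqC)
  refine ⟨?_, ?_, ?_, ?_, ?_⟩ <;>
    refine LaurentPolynomial.linearMap_ext fun n => ?_
  · simp [hK, hKinv, smul_smul, hne n]
  · simp [hK, hKinv, smul_smul, hne n]
  · simp only [LinearMap.comp_apply, LinearMap.smul_apply, hK, hE, map_smul, smul_smul, hshift]
    congr 1
    ring
  · simp only [LinearMap.comp_apply, LinearMap.smul_apply, hK, hF, map_smul, smul_smul, hunshift]
    congr 1
    ring
  · simp only [LinearMap.comp_apply, LinearMap.smul_apply, LinearMap.sub_apply, hK, hKinv, hE, hF,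
      map_smul, smul_smul, sub_add_cancel, add_sub_cancel_right, ← sub_smul]
    congr 1
    simp only [zpow_neg, hshift, hunshift, hneg_two]
    have hx := hne n
    generalize (q : ℂ) ^ (2 * n) = x at hx ⊢
    set s : ℂ := (Real.sqrt q : ℂ)
    trans -(s * s) * (((x⁻¹ - 1) * (1 - x * ((q : ℂ) ^ 2)⁻¹) - (1 - x) * ((x * (q : ℂ) ^ 2)⁻¹ - 1)) /
        ((((q : ℂ) ^ 2)⁻¹ - 1) * (1 - (q : ℂ) ^ 2)))
    · field_simp
      ring
    · rw [hsqrt, eq_inv_mul_iff_mul_eq₀ hqinv, mul_div_assoc', mul_div_assoc',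
        div_eq_iff (mul_ne_zero hinv hsq)]
      field_simp
      ring
end
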